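/- Fix N, n ≥ 1, let V = ℂ^N with standard basis, and let v_+ ∈ V be the first standard basis vector. Let 𝒱 = V^{⊗n} ⊗ ℂ[z_1,…,z_n]. For an N×N complex matrix g and an integer r ≥ 0 define the linear operator T_{g,r} on 𝒱 by T_{g,r}(p(z_1,…,z_n) v_1⊗…⊗v_n) = p(z_1,…,z_n) Σ_{s=1}^n z_s^r · v_1⊗…⊗(g v_s)⊗…⊗v_n (g acting in the s-th factor). Then the smallest linear subspace of 𝒱 that contains the vector v_+^{⊗n} ⊗ 1 and is invariant under all operators T_{g,r} (g an N×N matrix, r ≥ 0) is exactly the subspace 𝒱^S of S_n-invariant vectors, where S_n acts by permuting the tensor factors of V^{⊗n} and the variables z_1,…,z_n simultaneously. -/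

import Mathlib

open scoped TensorProduct

/-- The simultaneous action of a permutation σ on 𝒱 = V^{⊗n} ⊗ ℂ[z₁,…,zₙ] :
it permutes the tensor factors of the tensor power (v₁⊗…⊗vₙ ↦ v_{σ⁻¹(1)}⊗…⊗v_{σ⁻¹(n)})
and the variables of the polynomial (p(z₁,…,zₙ) ↦ p(z_{σ(1)},…,z_{σ(n)})). -/
noncomputable def permAct (N n : ℕ) (σ : Equiv.Perm (Fin n)) :
    ((⨂[ℂ] _i : Fin n, (Fin N → ℂ)) ⊗[ℂ] MvPolynomial (Fin n) ℂ) →ₗ[ℂ]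
      ((⨂[ℂ] _i : Fin n, (Fin N → ℂ)) ⊗[ℂ] MvPolynomial (Fin n) ℂ) :=
  TensorProduct.map
    ((PiTensorProduct.reindex ℂ (fun _ : Fin n => (Fin N → ℂ)) σ).toLinearMap)
    (MvPolynomial.rename σ).toLinearMap

/-- The operator T_{g,r} on 𝒱 = V^{⊗n} ⊗ ℂ[z₁,…,zₙ]: the sum over s = 1,…,n of the
operator applying the matrix g in the s-th tensor factor and multiplying the polynomial
part by z_s^r.  (This is the action of g ⊗ tʳ ∈ gl_N[t].) -/
noncomputable def currentAct (N n : ℕ) (g : Matrix (Fin N) (Fin N) ℂ) (r : ℕ) :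
    ((⨂[ℂ] _i : Fin n, (Fin N → ℂ)) ⊗[ℂ] MvPolynomial (Fin n) ℂ) →ₗ[ℂ]
      ((⨂[ℂ] _i : Fin n, (Fin N → ℂ)) ⊗[ℂ] MvPolynomial (Fin n) ℂ) :=
  ∑ s : Fin n,
    TensorProduct.map
      (PiTensorProduct.map (Function.update
        (fun _ : Fin n => (LinearMap.id : (Fin N → ℂ) →ₗ[ℂ] (Fin N → ℂ))) s
        (Matrix.toLin' g)))
      (LinearMap.mulLeft ℂ ((MvPolynomial.X s : MvPolynomial (Fin n) ℂ) ^ r))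

/-- The basic vectors. -/
noncomputable def bvec (N n : ℕ) (hN : 0 < N) (c : Fin n → Matrix (Fin N) (Fin N) ℂ × ℕ) :
    (⨂[ℂ] _i : Fin n, (Fin N → ℂ)) ⊗[ℂ] MvPolynomial (Fin n) ℂ :=
  (PiTensorProduct.tprod ℂ fun i : Fin n =>
      Matrix.toLin' (c i).1 (Pi.single (⟨0, hN⟩ : Fin N) (1 : ℂ)))
    ⊗ₜ[ℂ] (∏ i, (MvPolynomial.X i : MvPolynomial (Fin n) ℂ) ^ (c i).2)

/-- Product of labels. -/
def lmul {N : ℕ} (a b : Matrix (Fin N) (Fin N) ℂ × ℕ) : Matrix (Fin N) (Fin N) ℂ × ℕ :=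
  (a.1 * b.1, a.2 + b.2)

theorem currentAct_tmul (N n : ℕ) (g : Matrix (Fin N) (Fin N) ℂ) (r : ℕ)
    (v : Fin n → Fin N → ℂ) (p : MvPolynomial (Fin n) ℂ) :
    currentAct N n g r (PiTensorProduct.tprod ℂ v ⊗ₜ[ℂ] p) =
      ∑ s, (PiTensorProduct.tprod ℂ (Function.update v s (Matrix.toLin' g (v s)))) ⊗ₜ[ℂ]
        (MvPolynomial.X s ^ r * p) := by
  simp only [currentAct, LinearMap.sum_apply, TensorProduct.map_tmul, PiTensorProduct.map_tprod,
    LinearMap.mulLeft_apply]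
  refine Finset.sum_congr rfl fun s _ => ?_
  congr 2
  funext i
  by_cases h : i = s
  · subst h; simp
  · simp [h]

theorem permAct_tmul (N n : ℕ) (σ : Equiv.Perm (Fin n))
    (v : Fin n → Fin N → ℂ) (p : MvPolynomial (Fin n) ℂ) :
    permAct N n σ (PiTensorProduct.tprod ℂ v ⊗ₜ[ℂ] p) =
      (PiTensorProduct.tprod ℂ (fun i => v (σ.symm i))) ⊗ₜ[ℂ] (MvPolynomial.rename σ p) := by
  simp only [permAct, TensorProduct.map_tmul, LinearEquiv.coe_coe, AlgHom.toLinearMap_apply]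
  congr 1
  exact PiTensorProduct.reindex_tprod _ _

theorem perm_current_comm (N n : ℕ) (σ : Equiv.Perm (Fin n)) (g : Matrix (Fin N) (Fin N) ℂ)
    (r : ℕ) (y : (⨂[ℂ] _i : Fin n, (Fin N → ℂ)) ⊗[ℂ] MvPolynomial (Fin n) ℂ) :
    permAct N n σ (currentAct N n g r y) = currentAct N n g r (permAct N n σ y) := by
  induction y using TensorProduct.induction_on with
  | zero => simp
  | add x y hx hy => simp only [map_add, hx, hy]
  | tmul x p =>
    induction x using PiTensorProduct.induction_on with
    | add x y hx hy => simp only [TensorProduct.add_tmul, map_add, hx, hy]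
    | smul_tprod a v =>
      simp only [← TensorProduct.smul_tmul', map_smul]
      congr 1
      rw [permAct_tmul, currentAct_tmul, currentAct_tmul, map_sum]
      refine Fintype.sum_equiv σ _ _ fun s => ?_
      rw [permAct_tmul]
      simp only [map_mul, map_pow, MvPolynomial.rename_X]
      congr 2
      funext i
      by_cases h : i = σ s
      · subst h
        simp
        exact congrArg (fun t => g.mulVec (v t)) (σ.symm_apply_apply s).symm
      · have h2 : σ.symm i ≠ s := fun e => h (by simp [← e])
        simp [h, h2]

theorem currentAct_bvec (N n : ℕ) (hN : 0 < N) (a : Matrix (Fin N) (Fin N) ℂ × ℕ)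
    (c : Fin n → Matrix (Fin N) (Fin N) ℂ × ℕ) :
    currentAct N n a.1 a.2 (bvec N n hN c) =
      ∑ s, bvec N n hN (Function.update c s (lmul a (c s))) := by
  rw [bvec, currentAct_tmul]
  refine Finset.sum_congr rfl fun s _ => ?_
  rw [bvec]
  congr 2
  · funext i
    by_cases h : i = s
    · subst h; simp [lmul]
    · simp [h]
  · rw [← Finset.mul_prod_erase Finset.univ _ (Finset.mem_univ s),
      ← Finset.mul_prod_erase Finset.univ (fun i => (MvPolynomial.X i : MvPolynomial (Fin n) ℂ) ^
        (Function.update c s (lmul a (c s)) i).2) (Finset.mem_univ s)]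
    rw [← mul_assoc, ← pow_add]
    congr 1
    · simp [lmul]
    · refine Finset.prod_congr rfl fun i hi => ?_
      simp [Finset.ne_of_mem_erase hi]

/-- Symmetrized vectors. -/
noncomputable def symv (N n : ℕ) (hN : 0 < N) (c : Fin n → Matrix (Fin N) (Fin N) ℂ × ℕ) :
    (⨂[ℂ] _i : Fin n, (Fin N → ℂ)) ⊗[ℂ] MvPolynomial (Fin n) ℂ :=
  ∑ σ : Equiv.Perm (Fin n), bvec N n hN (c ∘ σ)

theorem symv_comp (N n : ℕ) (hN : 0 < N) (c : Fin n → Matrix (Fin N) (Fin N) ℂ × ℕ)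
    (τ : Equiv.Perm (Fin n)) : symv N n hN (c ∘ τ) = symv N n hN c := by
  unfold symv
  exact Fintype.sum_equiv (Equiv.mulLeft τ) _ _ fun σ => rfl

theorem currentAct_symv (N n : ℕ) (hN : 0 < N) (a : Matrix (Fin N) (Fin N) ℂ × ℕ)
    (c : Fin n → Matrix (Fin N) (Fin N) ℂ × ℕ) :
    currentAct N n a.1 a.2 (symv N n hN c) =
      ∑ t, symv N n hN (Function.update c t (lmul a (c t))) := by
  unfold symv
  rw [map_sum, Finset.sum_comm]
  refine Finset.sum_congr rfl fun σ _ => ?_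
  rw [currentAct_bvec]
  refine Fintype.sum_equiv σ _ _ fun s => ?_
  congr 1
  funext i
  by_cases h : i = s
  · subst h; simp
  · simp [h]

theorem mem_of_add_mem {M : Type*} [AddCommMonoid M] [Module ℂ M] (p : Submodule ℂ M) {x y : M}
    (hx : x ∈ p) (h : x + y ∈ p) : y ∈ p := by
  have h1 := p.add_mem (p.smul_mem (-1 : ℂ) hx) h
  have e : (-1 : ℂ) • x + x = 0 := by
    calc (-1 : ℂ) • x + x = ((-1 : ℂ) + 1) • x := by rw [add_smul, one_smul]
      _ = 0 := by simp
  rwa [← add_assoc, e, zero_add] at h1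

open Classical in
theorem symv_mem (N n : ℕ) (hN : 0 < N)
    (p : Submodule ℂ ((⨂[ℂ] _i : Fin n, (Fin N → ℂ)) ⊗[ℂ] MvPolynomial (Fin n) ℂ))
    (h0 : bvec N n hN (fun _ => (1, 0)) ∈ p)
    (hp : ∀ (g : Matrix (Fin N) (Fin N) ℂ) (r : ℕ), ∀ y ∈ p, currentAct N n g r y ∈ p)
    (k : ℕ) : ∀ c : Fin n → Matrix (Fin N) (Fin N) ℂ × ℕ,
      (Finset.univ.filter fun i => c i ≠ (1, 0)).card ≤ k → symv N n hN c ∈ p := by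
  induction k with
  | zero =>
    intro c hc
    have hc' : c = fun _ => (1, 0) := by
      funext i
      by_contra h
      have : i ∈ (Finset.univ.filter fun i => c i ≠ (1, 0)) := by simp [h]
      rw [Finset.card_eq_zero.mp (Nat.le_zero.mp hc)] at this
      simp at this
    subst hc'
    exact Submodule.sum_mem _ fun σ _ => h0
  | succ k ih =>
    intro c hc
    by_cases hk : (Finset.univ.filter fun i => c i ≠ (1, 0)).card ≤ k
    · exact ih c hk
    have hne : (Finset.univ.filter fun i => c i ≠ (1, 0)).Nonempty := by
      rw [← Finset.card_pos]; omega
    obtain ⟨s, hs⟩ := hne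
    set c' := Function.update c s (1, 0) with hc'
    have hsupp : (Finset.univ.filter fun i => c' i ≠ (1, 0)) =
        (Finset.univ.filter fun i => c i ≠ (1, 0)).erase s := by
      ext i
      by_cases h : i = s
      · subst h; simp [hc']
      · simp [hc', h]
    have hcard : (Finset.univ.filter fun i => c' i ≠ (1, 0)).card ≤ k := by
      rw [hsupp, Finset.card_erase_of_mem hs]; omega
    have hT := hp (c s).1 (c s).2 _ (ih c' hcard)
    rw [currentAct_symv, ← Finset.sum_filter_add_sum_filter_not Finset.univ
      (fun i => c' i ≠ (1, 0))] at hT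
    have h1 : ∑ t ∈ Finset.univ.filter (fun i => c' i ≠ (1, 0)),
        symv N n hN (Function.update c' t (lmul (c s) (c' t))) ∈ p := by
      refine Submodule.sum_mem _ fun t ht => ih _ (le_trans (Finset.card_le_card ?_) hcard)
      intro i hi
      by_cases h : i = t
      · subst h; exact ht
      · simpa [h] using hi
    have h2 := mem_of_add_mem p h1 hT
    have h3 : ∀ t ∈ Finset.univ.filter (fun i => ¬ (c' i ≠ (1, 0))),
        symv N n hN (Function.update c' t (lmul (c s) (c' t))) = symv N n hN c := by
      intro t ht
      have ht' : c' t = (1, 0) := by simpa using ht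
      rw [ht', ← symv_comp N n hN c (Equiv.swap s t)]
      congr 1
      funext i
      have hl : lmul (c s) (1, 0) = c s := by simp [lmul]
      rw [hl]
      by_cases h : i = t
      · subst h; simp
      · by_cases h' : i = s
        · subst h'
          have : c' t = c t := by simp [hc', Ne.symm h]
          have h4 : c t = (1, 0) := this.symm.trans ht'
          simp [h, hc', h4]
        · simp [h, h', hc', Equiv.swap_apply_of_ne_of_ne h' h]
    rw [Finset.sum_congr rfl h3, Finset.sum_const, ← Nat.cast_smul_eq_nsmul ℂ] at h2
    refine (Submodule.smul_mem_iff p ?_).mp h2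
    rw [Nat.cast_ne_zero]
    refine (Finset.card_pos.mpr ⟨s, ?_⟩).ne'
    simp [hc']

theorem sum_perm_mem (N n : ℕ) (hN : 0 < N)
    (p : Submodule ℂ ((⨂[ℂ] _i : Fin n, (Fin N → ℂ)) ⊗[ℂ] MvPolynomial (Fin n) ℂ))
    (hp : ∀ c, symv N n hN c ∈ p)
    (y : (⨂[ℂ] _i : Fin n, (Fin N → ℂ)) ⊗[ℂ] MvPolynomial (Fin n) ℂ) :
    (∑ σ, permAct N n σ) y ∈ p := by
  induction y using TensorProduct.induction_on with
  | zero => simp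
  | add x y hx hy => rw [map_add]; exact p.add_mem hx hy
  | tmul x q =>
    induction x using PiTensorProduct.induction_on with
    | add x y hx hy => rw [TensorProduct.add_tmul, map_add]; exact p.add_mem hx hy
    | smul_tprod a v =>
      rw [← TensorProduct.smul_tmul', map_smul]
      refine p.smul_mem _ ?_
      induction q using MvPolynomial.induction_on' with
      | add x y hx hy => rw [TensorProduct.tmul_add, map_add]; exact p.add_mem hx hy
      | monomial d b =>
        have hd : (MvPolynomial.monomial d b : MvPolynomial (Fin n) ℂ) =
            b • ∏ i, (MvPolynomial.X i : MvPolynomial (Fin n) ℂ) ^ (d i) := by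
          rw [MvPolynomial.monomial_eq, MvPolynomial.smul_eq_C_mul, Finsupp.prod_fintype]
          simp
        rw [hd, TensorProduct.tmul_smul, map_smul]
        refine p.smul_mem _ ?_
        convert hp (fun i => (Matrix.of fun j _ => v i j, d i)) using 1
        rw [symv, LinearMap.sum_apply]
        refine Fintype.sum_equiv (Equiv.inv _) _ _ fun σ => ?_
        rw [permAct_tmul, bvec]
        congr 2
        · funext i j
          simp [Matrix.toLin'_apply, Matrix.mulVec_single]
        · rw [map_prod]
          refine Fintype.prod_equiv σ _ _ fun i => ?_
          simp

/-- The smallest linear subspace of 𝒱 = V^{⊗n} ⊗ ℂ[z₁,…,zₙ] containing the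
vector v₊^{⊗n} ⊗ 1 (v₊ the first standard basis vector of ℂᴺ) and invariant under all
the operators T_{g,r} is exactly the subspace 𝒱^S of Sₙ-invariant vectors.
(I.e. 𝒱^S is a cyclic gl_N[t]-module with cyclic vector v₊^{⊗n}.) -/
theorem stmt_4 (N n : ℕ) (hN : 0 < N) (hn : 1 ≤ n) :
    sInf {p : Submodule ℂ ((⨂[ℂ] _i : Fin n, (Fin N → ℂ)) ⊗[ℂ] MvPolynomial (Fin n) ℂ) |
        ((PiTensorProduct.tprod ℂ fun _ : Fin n => Pi.single (⟨0, hN⟩ : Fin N) (1 : ℂ))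
            ⊗ₜ[ℂ] (1 : MvPolynomial (Fin n) ℂ)) ∈ p ∧
        ∀ (g : Matrix (Fin N) (Fin N) ℂ) (r : ℕ), ∀ y ∈ p, currentAct N n g r y ∈ p} =
      ⨅ σ : Equiv.Perm (Fin n), LinearMap.eqLocus (permAct N n σ) LinearMap.id := by
  have hb : bvec N n hN (fun _ => (1, 0)) =
      ((PiTensorProduct.tprod ℂ fun _ : Fin n => Pi.single (⟨0, hN⟩ : Fin N) (1 : ℂ))
            ⊗ₜ[ℂ] (1 : MvPolynomial (Fin n) ℂ)) := by
    simp [bvec]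
  apply le_antisymm
  · refine sInf_le ⟨?_, ?_⟩
    · simp only [Submodule.mem_iInf, LinearMap.mem_eqLocus]
      intro σ
      rw [permAct_tmul]
      simp
    · intro g r y hy
      simp only [Submodule.mem_iInf, LinearMap.mem_eqLocus, LinearMap.id_apply] at hy ⊢
      intro σ
      rw [perm_current_comm, hy]
  · refine le_sInf ?_
    rintro p ⟨h0, hp⟩ y hy
    simp only [Submodule.mem_iInf, LinearMap.mem_eqLocus, LinearMap.id_apply] at hy
    rw [← hb] at h0
    have h := sum_perm_mem N n hN p (fun c => symv_mem N n hN p h0 hp _ c le_rfl) y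
    rw [LinearMap.sum_apply, Finset.sum_congr rfl (fun σ _ => hy σ), Finset.sum_const,
      ← Nat.cast_smul_eq_nsmul ℂ] at h
    refine (Submodule.smul_mem_iff p ?_).mp h
    rw [Nat.cast_ne_zero]
    exact (Finset.card_pos.mpr ⟨1, Finset.mem_univ _⟩).ne'
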